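/- Consider the MultiGGFL splitting problem: minimize ℓ(Θ) + Ω(W) + Φ(Z) + Ψ(U) subject to 𝒫Θ − W = 0, 𝒬Θ − Z = 0, Θ − U = 0, where all functions are convex and real-valued on finite-dimensional spaces as specified below, the Θ-subproblem and the (W, Z, U)-subproblem of the augmented Lagrangian each have unique minimizers, and the problem has an optimal solution. Fix σ > 0 and an initial point H₀ = (Θ₀, W₀, Z₀, U₀, S₀, T₀, R₀). Define the HPR iteration: (Step 1) Θ̄_{k+1} = argmin_Θ 𝓛_σ(Θ, W_k, Z_k, U_k; S_k, T_k, R_k); (Step 2) S̄_{k+1} = S_k + σ(𝒫Θ̄_{k+1} − W_k), T̄_{k+1} = T_k + σ(𝒬Θ̄_{k+1} − Z_k), R̄_{k+1} = R_k + σ(Θ̄_{k+1} − U_k); (Step 3) (W̄_{k+1}, Z̄_{k+1}, Ū_{k+1}) = argmin_{W,Z,U} 𝓛_σ(Θ̄_{k+1}, W, Z, U; S̄_{k+1}, T̄_{k+1}, R̄_{k+1}); (Step 4) Ĥ_{k+1} = 2H̄_{k+1} − H_k; (Step 5) H_{k+1} = (1/(k+2))H₀ + ((k+1)/(k+2))Ĥ_{k+1},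 where H̄_{k+1} = (Θ̄_{k+1}, W̄_{k+1}, Z̄_{k+1}, Ū_{k+1}, S̄_{k+1}, T̄_{k+1}, R̄_{k+1}). Then the sequence {H̄_k} converges to a point H* = (Θ*, W*, Z*, U*, S*, T*, R*) satisfying the KKT system: 0 = ∇ℓ(Θ*) + 𝒫*S* + 𝒬*T* + R*, S* ∈ ∂Ω(W*), T* ∈ ∂Φ(Z*), R* ∈ ∂Ψ(U*), 𝒫Θ* − W* = 0, 𝒬Θ* − Z* = 0, Θ* − U* = 0. In particular, (Θ*, W*, Z*, U*) is an optimal solution of the problem. -/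

import Mathlib

open Matrix Filter

/-- Frobenius inner product on real matrices. -/
noncomputable def frob {a b : ℕ} (A B : Matrix (Fin a) (Fin b) ℝ) : ℝ :=
  ∑ i, ∑ j, A i j * B i j

/-- Frobenius inner product on families (one matrix per task). -/
noncomputable def ipF {a b m : ℕ} (A B : Fin m → Matrix (Fin a) (Fin b) ℝ) : ℝ :=
  ∑ r, frob (A r) (B r)

/-- ℓ₁ norm on ℝ^d. -/
noncomputable def l1 {d : ℕ} (x : Fin d → ℝ) : ℝ := ∑ k, |x k|

/-- Euclidean (ℓ₂) norm on ℝ^d. -/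
noncomputable def l2 {d : ℕ} (x : Fin d → ℝ) : ℝ := Real.sqrt (∑ k, (x k) ^ 2)

/-- ℓ_p norm on ℝ^d (real exponent p ≥ 1). -/
noncomputable def lpNorm {d : ℕ} (p : ℝ) (x : Fin d → ℝ) : ℝ :=
  (∑ k, |x k| ^ p) ^ (1 / p)

/-- Squared loss ℓ(Θ) = (1/2) Σ_r ‖y⁽ʳ⁾ − 𝒳(Θ⁽ʳ⁾)‖₂². -/
noncomputable def lossF (t s n m : ℕ) (X : Fin n → Matrix (Fin t) (Fin s) ℝ)
    (y : Fin m → Fin n → ℝ) (Θ : Fin m → Matrix (Fin t) (Fin s) ℝ) : ℝ :=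
  (1 / 2) * ∑ r, ∑ k, (y r k - frob (X k) (Θ r)) ^ 2

/-- Temporal regularizer Ω(W) = λ_t Σ_r Σ_i ‖W⁽ʳ⁾_{i·}‖_p. -/
noncomputable def OmegaF (d s m : ℕ) (lamt p : ℝ)
    (W : Fin m → Matrix (Fin d) (Fin s) ℝ) : ℝ :=
  lamt * ∑ r, ∑ i, lpNorm p (fun j => W r i j)

/-- Spatial regularizer Φ(Z) = λ_g Σ_r Σ_{(j,j')∈ℰ} w_{jj'} ‖Z⁽ʳ⁾_{·ι(j,j')}‖_q. -/
noncomputable def PhiF (t e m s : ℕ) (lamg q : ℝ) (E : Finset (Fin s × Fin s))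
    (w : Fin s × Fin s → ℝ) (ι : {x // x ∈ E} ≃ Fin e)
    (Z : Fin m → Matrix (Fin t) (Fin e) ℝ) : ℝ :=
  lamg * ∑ r, ∑ a : {x // x ∈ E}, w a.1 * lpNorm q (fun i => Z r i (ι a))

/-- Cross-task sparse group lasso Ψ(U) = Σ_{i,j} (λ₁‖U_{[ij]}‖₁ + λ₂‖U_{[ij]}‖₂). -/
noncomputable def PsiF (t s m : ℕ) (lam1 lam2 : ℝ)
    (U : Fin m → Matrix (Fin t) (Fin s) ℝ) : ℝ :=
  ∑ i : Fin t, ∑ j : Fin s,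
    (lam1 * l1 (fun r => U r i j) + lam2 * l2 (fun r => U r i j))

/-- Objective F(Θ, W, Z, U) = ℓ(Θ) + Ω(W) + Φ(Z) + Ψ(U). -/
noncomputable def objF (t s e n m : ℕ) (X : Fin n → Matrix (Fin t) (Fin s) ℝ)
    (y : Fin m → Fin n → ℝ) (lamt lamg lam1 lam2 p q : ℝ)
    (E : Finset (Fin s × Fin s)) (w : Fin s × Fin s → ℝ) (ι : {x // x ∈ E} ≃ Fin e)
    (Θ : Fin m → Matrix (Fin t) (Fin s) ℝ)
    (W : Fin m → Matrix (Fin (t - 1)) (Fin s) ℝ)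
    (Z : Fin m → Matrix (Fin t) (Fin e) ℝ)
    (U : Fin m → Matrix (Fin t) (Fin s) ℝ) : ℝ :=
  lossF t s n m X y Θ + OmegaF (t - 1) s m lamt p W + PhiF t e m s lamg q E w ι Z
    + PsiF t s m lam1 lam2 U

/-- Augmented Lagrangian 𝓛_σ(Θ, W, Z, U; S, T, R). -/
noncomputable def LagF (t s e n m : ℕ) (X : Fin n → Matrix (Fin t) (Fin s) ℝ)
    (y : Fin m → Fin n → ℝ) (lamt lamg lam1 lam2 p q : ℝ)
    (E : Finset (Fin s × Fin s)) (w : Fin s × Fin s → ℝ) (ι : {x // x ∈ E} ≃ Fin e)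
    (P : Matrix (Fin (t - 1)) (Fin t) ℝ) (B : Matrix (Fin s) (Fin e) ℝ) (σ : ℝ)
    (Θ : Fin m → Matrix (Fin t) (Fin s) ℝ)
    (W : Fin m → Matrix (Fin (t - 1)) (Fin s) ℝ)
    (Z : Fin m → Matrix (Fin t) (Fin e) ℝ)
    (U : Fin m → Matrix (Fin t) (Fin s) ℝ)
    (S : Fin m → Matrix (Fin (t - 1)) (Fin s) ℝ)
    (T : Fin m → Matrix (Fin t) (Fin e) ℝ)
    (R : Fin m → Matrix (Fin t) (Fin s) ℝ) : ℝ :=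
  objF t s e n m X y lamt lamg lam1 lam2 p q E w ι Θ W Z U
    + ipF S (fun r => P * Θ r - W r) + ipF T (fun r => Θ r * B - Z r)
    + ipF R (fun r => Θ r - U r)
    + (σ / 2) * (ipF (fun r => P * Θ r - W r) (fun r => P * Θ r - W r)
        + ipF (fun r => Θ r * B - Z r) (fun r => Θ r * B - Z r)
        + ipF (fun r => Θ r - U r) (fun r => Θ r - U r))

/-- A nonnegative sequence with `(k + 2) a (k + 1) ≤ (k + 1) a k + δ k` and `δ → 0` tends to `0`. -/
theorem tendsto_zero_of_weighted_le {a δ : ℕ → ℝ} (ha : ∀ k, 0 ≤ a k)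
    (hδ : Tendsto δ atTop (nhds 0))
    (h : ∀ k : ℕ, ((k : ℝ) + 2) * a (k + 1) ≤ ((k : ℝ) + 1) * a k + δ k) :
    Tendsto a atTop (nhds 0) := by
  have hsum : ∀ k : ℕ, ((k : ℝ) + 1) * a k ≤ a 0 + ∑ j ∈ Finset.range k, δ j := by
    intro k
    induction k with
    | zero => simp
    | succ k ih =>
      rw [Finset.sum_range_succ]
      push_cast
      linarith [h k]
  have hces := hδ.cesaro
  have h0 : Tendsto (fun k : ℕ => (k : ℝ)⁻¹ * a 0) atTop (nhds 0) := by
    simpa using tendsto_inv_atTop_nhds_zero_nat.mul_const (a 0)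
  have hlim := h0.add hces
  rw [add_zero] at hlim
  refine squeeze_zero' (Eventually.of_forall ha) ?_ hlim
  filter_upwards [eventually_gt_atTop 0] with k hk
  have hk' : (0 : ℝ) < k := by exact_mod_cast hk
  rw [← mul_add, inv_mul_eq_div, le_div_iff₀ hk']
  nlinarith [hsum k, ha k]

section Halpern

variable {F : Type*} [NormedAddCommGroup F] [InnerProductSpace ℝ F]

/-- The fixed-point set of a nonexpansive map of an inner product space is convex. -/
theorem convex_fixedPoints_of_nonexpansive {R : F → F} (hR : ∀ x y, ‖R x - R y‖ ≤ ‖x - y‖) :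
    Convex ℝ {x | R x = x} := by
  intro z hz p hp a b ha hb hab
  simp only [Set.mem_ofPred_eq] at hz hp ⊢
  set c := a • z + b • p with hc
  obtain rfl : b = 1 - a := by linarith
  have key : ∀ v : F, ‖v - c‖ ^ 2
      = a * ‖v - z‖ ^ 2 + (1 - a) * ‖v - p‖ ^ 2 - a * (1 - a) * ‖z - p‖ ^ 2 := by
    intro v
    have e1 : v - c = a • (v - z) + (1 - a) • (v - p) := by rw [hc]; module
    have e2 : z - p = (v - p) - (v - z) := by abel
    rw [e1, e2, @norm_sub_sq_real _ _ _ (v - p) (v - z), @norm_add_sq_real, norm_smul, norm_smul, inner_smul_left,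
      inner_smul_right, Real.norm_eq_abs, Real.norm_eq_abs, mul_pow, mul_pow, sq_abs, sq_abs,
      real_inner_comm (v - z) (v - p)]
    simp only [conj_trivial]
    ring
  have h1 : ‖R c - z‖ ≤ ‖c - z‖ := by simpa [hz] using hR c z
  have h2 : ‖R c - p‖ ≤ ‖c - p‖ := by simpa [hp] using hR c p
  have h1' := mul_le_mul_of_nonneg_left (pow_le_pow_left₀ (norm_nonneg _) h1 2) ha
  have h2' := mul_le_mul_of_nonneg_left (pow_le_pow_left₀ (norm_nonneg _) h2 2) hb
  have k1 := key (R c)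
  have k2 := key c
  rw [sub_self, norm_zero] at k2
  have : ‖R c - c‖ ^ 2 = 0 := le_antisymm (by linarith) (sq_nonneg _)
  exact sub_eq_zero.1 (norm_eq_zero.1 (pow_eq_zero_iff two_ne_zero |>.1 this))

theorem halpern_dist_le {R : F → F} (hR : ∀ x y, ‖R x - R y‖ ≤ ‖x - y‖) {x : ℕ → F}
    (hx : ∀ k : ℕ, x (k + 1) = (1 / ((k : ℝ) + 2)) • x 0
      + (((k : ℝ) + 1) / ((k : ℝ) + 2)) • R (x k)) {p : F} (hp : R p = p) (k : ℕ) :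
    ‖x k - p‖ ≤ ‖x 0 - p‖ := by
  induction k with
  | zero => exact le_rfl
  | succ k ih =>
    have hk : (0 : ℝ) < (k : ℝ) + 2 := by positivity
    have e : x (k + 1) - p = (1 / ((k : ℝ) + 2)) • (x 0 - p)
        + (((k : ℝ) + 1) / ((k : ℝ) + 2)) • (R (x k) - p) := by
      rw [hx k]
      have : p = (1 / ((k : ℝ) + 2)) • p + (((k : ℝ) + 1) / ((k : ℝ) + 2)) • p := by
        rw [← add_smul, ← add_div, show (1 : ℝ) + (k + 1) = k + 2 by ring, div_self hk.ne', one_smul]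
      nth_rewrite 1 [this]
      module
    have hRk : ‖R (x k) - p‖ ≤ ‖x 0 - p‖ := by
      refine le_trans ?_ ih
      simpa [hp] using hR (x k) p
    rw [e]
    refine (norm_add_le _ _).trans ?_
    rw [norm_smul, norm_smul, Real.norm_of_nonneg (by positivity),
      Real.norm_of_nonneg (by positivity)]
    have h1 : (((k : ℝ) + 1) / ((k : ℝ) + 2)) * ‖R (x k) - p‖
        ≤ (((k : ℝ) + 1) / ((k : ℝ) + 2)) * ‖x 0 - p‖ :=
      mul_le_mul_of_nonneg_left hRk (by positivity)
    have h2 : 1 / ((k : ℝ) + 2) * ‖x 0 - p‖ + (((k : ℝ) + 1) / ((k : ℝ) + 2)) * ‖x 0 - p‖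
        = ‖x 0 - p‖ := by field_simp; ring
    linarith

/-- Asymptotic regularity of the Halpern iteration. -/
theorem halpern_tendsto_sub {R : F → F} (hR : ∀ x y, ‖R x - R y‖ ≤ ‖x - y‖) {x : ℕ → F}
    (hx : ∀ k : ℕ, x (k + 1) = (1 / ((k : ℝ) + 2)) • x 0
      + (((k : ℝ) + 1) / ((k : ℝ) + 2)) • R (x k)) {p : F} (hp : R p = p) :
    Tendsto (fun k => x k - R (x k)) atTop (nhds 0) := by
  have hdist := halpern_dist_le hR hx hp
  have hM : ∀ k, ‖x 0 - R (x k)‖ ≤ 2 * ‖x 0 - p‖ := by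
    intro k
    have h1 : ‖R (x k) - p‖ ≤ ‖x 0 - p‖ := by
      have := hR (x k) p
      rw [hp] at this
      exact this.trans (hdist k)
    have h2 : x 0 - R (x k) = (x 0 - p) - (R (x k) - p) := by abel
    rw [h2]
    linarith [norm_sub_le (x 0 - p) (R (x k) - p)]
  have hinv : Tendsto (fun k : ℕ => (2 * ‖x 0 - p‖) * (1 / ((k : ℝ) + 1))) atTop (nhds 0) := by
    simpa using tendsto_one_div_add_atTop_nhds_zero_nat.const_mul (2 * ‖x 0 - p‖)
  have hb : Tendsto (fun k => ‖x k - x (k - 1)‖) atTop (nhds 0) := by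
    refine tendsto_zero_of_weighted_le (fun k => norm_nonneg _) hinv ?_
    rintro (_ | k)
    · have hA : (2 : ℝ) • (x 1 - x 0) = -(x 0 - R (x 0)) := by
        have e := hx 0
        simp only [zero_add, Nat.cast_zero] at e
        rw [e]
        module
      have hB := congrArg norm hA
      rw [norm_smul, norm_neg, Real.norm_of_nonneg zero_le_two] at hB
      simpa [hB] using hM 0
    · simp only [Nat.add_sub_cancel]
      have hk2 : (0 : ℝ) < (k : ℝ) + 2 := by positivity
      have hk3 : (0 : ℝ) < (k : ℝ) + 3 := by positivity
      have hA : ((k : ℝ) + 3) • (x (k + 2) - x (k + 1))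
          = (-(1 / ((k : ℝ) + 2))) • (x 0 - R (x k))
            + ((k : ℝ) + 2) • (R (x (k + 1)) - R (x k)) := by
        have e2 := hx (k + 1)
        push_cast at e2
        rw [show (k : ℝ) + 1 + 2 = k + 3 by ring, show (k : ℝ) + 1 + 1 = k + 2 by ring] at e2
        rw [show k + 2 = k + 1 + 1 from rfl, e2, smul_sub, smul_add, smul_smul, smul_smul,
          mul_div_cancel₀ _ hk3.ne', mul_div_cancel₀ _ hk3.ne', hx k]
        match_scalars <;> field_simp <;> ring
      have hB := congrArg norm hA
      rw [norm_smul, Real.norm_of_nonneg hk3.le] at hB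
      have hC : ‖(-(1 / ((k : ℝ) + 2))) • (x 0 - R (x k))
            + ((k : ℝ) + 2) • (R (x (k + 1)) - R (x k))‖
          ≤ 1 / ((k : ℝ) + 2) * (2 * ‖x 0 - p‖) + ((k : ℝ) + 2) * ‖x (k + 1) - x k‖ := by
        refine (norm_add_le _ _).trans ?_
        rw [norm_smul, norm_smul, norm_neg, Real.norm_of_nonneg (by positivity),
          Real.norm_of_nonneg hk2.le]
        gcongr
        · exact hM k
        · exact hR _ _
      rw [← hB] at hC
      push_cast
      rw [show (k : ℝ) + 1 + 2 = k + 3 by ring, show (k : ℝ) + 1 + 1 = k + 2 by ring]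
      linarith
  have hd : Tendsto (fun k => ‖x (k + 1) - x k‖) atTop (nhds 0) := by
    exact hb.comp (tendsto_add_atTop_nat 1)
  have hstep : Tendsto (fun k : ℕ => (2 * ‖x 0 - p‖) * (1 / ((k : ℝ) + 1)) + ‖x (k + 1) - x k‖)
      atTop (nhds 0) := by simpa using hinv.add hd
  refine squeeze_zero_norm (fun k => ?_) hstep
  have e : x k - R (x k) = (1 / ((k : ℝ) + 2)) • (x 0 - R (x k)) - (x (k + 1) - x k) := by
    rw [hx k]
    match_scalars <;> field_simp <;> ring
  rw [e]
  refine (norm_sub_le _ _).trans ?_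
  rw [norm_smul, Real.norm_of_nonneg (by positivity), mul_comm]
  gcongr
  · exact hM k
  · linarith


/-- Wittmann's theorem in finite dimension: the Halpern iteration of a nonexpansive map with a
fixed point converges to a fixed point. -/
theorem exists_tendsto_halpern [FiniteDimensional ℝ F] {R : F → F}
    (hR : ∀ x y, ‖R x - R y‖ ≤ ‖x - y‖) {x : ℕ → F}
    (hx : ∀ k : ℕ, x (k + 1) = (1 / ((k : ℝ) + 2)) • x 0
      + (((k : ℝ) + 1) / ((k : ℝ) + 2)) • R (x k)) (hfix : ∃ p, R p = p) :
    ∃ p, R p = p ∧ Tendsto x atTop (nhds p) := by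
  have : ProperSpace F := FiniteDimensional.proper ℝ F
  have hRc : Continuous R := by
    have : LipschitzWith 1 R := LipschitzWith.of_dist_le_mul fun a b => by
      simpa [dist_eq_norm] using hR a b
    exact this.continuous
  have hclosed : IsClosed {x | R x = x} := isClosed_eq hRc continuous_id
  have hconv := convex_fixedPoints_of_nonexpansive hR
  obtain ⟨p, hp, hmin⟩ := exists_norm_eq_iInf_of_complete_convex hfix hclosed.isComplete hconv (x 0)
  have hproj := (norm_eq_iInf_iff_real_inner_le_zero hconv hp).1 hmin
  refine ⟨p, hp, ?_⟩
  have hp' : R p = p := hp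
  have hdist := halpern_dist_le hR hx hp'
  have hreg := halpern_tendsto_sub hR hx hp'
  have hlim : ∀ ε > 0, ∀ᶠ k in atTop, inner ℝ (x 0 - p) (x k - p) < ε := by
    intro ε hε
    by_contra hcon
    obtain ⟨φ, hφ, hφε⟩ := extraction_of_frequently_atTop (not_eventually.1 hcon)
    obtain ⟨a, -, ψ, hψ, hlima⟩ := (isCompact_closedBall p ‖x 0 - p‖).tendsto_subseq
      (x := fun j => x (φ j)) fun j => by simpa [dist_eq_norm] using hdist (φ j)
    have hRa : R a = a := by
      have h1 : Tendsto (fun j => x (φ (ψ j)) - R (x (φ (ψ j)))) atTop (nhds 0) :=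
        hreg.comp (hφ.tendsto_atTop.comp hψ.tendsto_atTop)
      have h2 := hlima.sub ((hRc.tendsto a).comp hlima)
      exact (sub_eq_zero.1 (tendsto_nhds_unique h2 h1)).symm
    have h3 : Tendsto (fun j => inner ℝ (x 0 - p) (x (φ (ψ j)) - p)) atTop
        (nhds (inner ℝ (x 0 - p) (a - p))) :=
      tendsto_const_nhds.inner (hlima.sub tendsto_const_nhds)
    have h4 := ge_of_tendsto' h3 fun j => not_lt.1 (hφε (ψ j))
    linarith [hproj a hRa]
  have hmax : Tendsto (fun k => max 0 (2 * inner ℝ (x 0 - p) (x (k + 1) - p))) atTop (nhds 0) := by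
    rw [Metric.tendsto_nhds]
    intro ε hε
    filter_upwards [(tendsto_add_atTop_nat 1).eventually (hlim (ε / 2) (half_pos hε))] with k hk
    rw [Real.dist_eq, sub_zero, abs_of_nonneg (le_max_left _ _)]
    exact max_lt hε (by linarith)
  have hsq : Tendsto (fun k => ‖x k - p‖ ^ 2) atTop (nhds 0) := by
    refine tendsto_zero_of_weighted_le (fun k => sq_nonneg _) hmax ?_
    intro k
    have hk1 : (0 : ℝ) ≤ (k : ℝ) + 1 := by positivity
    have hk2 : (0 : ℝ) < (k : ℝ) + 2 := by positivity
    have e : ((k : ℝ) + 2) • (x (k + 1) - p) = (x 0 - p) + ((k : ℝ) + 1) • (R (x k) - p) := by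
      rw [hx k]
      match_scalars
      · field_simp
      · field_simp
      · field_simp
        ring
    have e' : ((k : ℝ) + 1) • (R (x k) - p) = ((k : ℝ) + 2) • (x (k + 1) - p) - (x 0 - p) := by
      rw [e]; abel
    have hn := congrArg (fun v => ‖v‖ ^ 2) e'
    rw [@norm_sub_sq_real, norm_smul, norm_smul, inner_smul_left, Real.norm_of_nonneg hk1,
      Real.norm_of_nonneg hk2.le, conj_trivial, real_inner_comm] at hn
    have hRk : ‖R (x k) - p‖ ^ 2 ≤ ‖x k - p‖ ^ 2 := by
      refine pow_le_pow_left₀ (norm_nonneg _) ?_ 2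
      simpa [hp'] using hR (x k) p
    have hm := le_max_right 0 (2 * inner ℝ (x 0 - p) (x (k + 1) - p))
    have h5 : (((k : ℝ) + 1) * ‖R (x k) - p‖) ^ 2 ≤ ((k : ℝ) + 1) * ((k : ℝ) + 2) * ‖x k - p‖ ^ 2 := by
      rw [mul_pow]
      nlinarith [mul_le_mul_of_nonneg_left hRk (sq_nonneg ((k : ℝ) + 1)),
        mul_nonneg hk1 (sq_nonneg ‖x k - p‖)]
    have h6 : ((k : ℝ) + 2) * (((k : ℝ) + 2) * ‖x (k + 1) - p‖ ^ 2)
        ≤ ((k : ℝ) + 2) * (((k : ℝ) + 1) * ‖x k - p‖ ^ 2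
          + max 0 (2 * inner ℝ (x 0 - p) (x (k + 1) - p))) := by
      nlinarith [mul_le_mul_of_nonneg_left hm hk2.le, sq_nonneg ‖x 0 - p‖]
    exact le_of_mul_le_mul_left h6 hk2
  rw [tendsto_iff_norm_sub_tendsto_zero]
  have := hsq.sqrt
  simpa [Real.sqrt_sq] using this

end Halpern

section Splitting

variable {E F : Type*} [AddCommGroup E] [Module ℝ E] [NormedAddCommGroup F] [InnerProductSpace ℝ F]

theorem nonneg_of_forall_add_mul_nonneg {D K : ℝ} (h : ∀ τ : ℝ, 0 < τ → τ ≤ 1 → 0 ≤ D + τ * K) :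
    0 ≤ D := by
  have ht : Tendsto (fun τ : ℝ => D + τ * K) (nhdsWithin 0 (Set.Ioi 0)) (nhds (D + 0 * K)) :=
    (Continuous.tendsto (by fun_prop) 0).mono_left nhdsWithin_le_nhds
  rw [zero_mul, add_zero] at ht
  refine ge_of_tendsto ht ?_
  filter_upwards [Ioc_mem_nhdsGT (zero_lt_one (α := ℝ))] with τ hτ
  exact h τ hτ.1 hτ.2

/-- First-order optimality for a convex function plus a linear and a quadratic penalty. -/
theorem subgradient_of_isMin_penalized {h : E → ℝ}
    (hconv : ∀ x x' : E, ∃ c, ∀ τ : ℝ, 0 < τ → τ ≤ 1 →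
      h (x + τ • (x' - x)) ≤ h x + τ * (h x' - h x) + τ ^ 2 * c)
    (L : E →ₗ[ℝ] F) (Y b : F) (σ : ℝ) {x : E}
    (hmin : ∀ x', h x + inner ℝ Y (L x - b) + σ / 2 * ‖L x - b‖ ^ 2
      ≤ h x' + inner ℝ Y (L x' - b) + σ / 2 * ‖L x' - b‖ ^ 2) (x' : E) :
    h x - inner ℝ (Y + σ • (L x - b)) (L (x' - x)) ≤ h x' := by
  obtain ⟨c, hc⟩ := hconv x x'
  set d := L (x' - x) with hd
  set K := c + σ / 2 * ‖d‖ ^ 2 with hK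
  set D := h x' - h x + inner ℝ (Y + σ • (L x - b)) d with hD
  have key : ∀ τ : ℝ, 0 < τ → τ ≤ 1 → 0 ≤ D + τ * K := by
    intro τ hτ hτ1
    have h1 := hmin (x + τ • (x' - x))
    have h2 := hc τ hτ hτ1
    have e : L (x + τ • (x' - x)) - b = (L x - b) + τ • d := by
      rw [map_add, map_smul]; abel
    rw [e, inner_add_right, inner_smul_right, @norm_add_sq_real, norm_smul, inner_smul_right,
      Real.norm_of_nonneg hτ.le] at h1
    have h3 : 0 ≤ τ * (D + τ * K) := by
      rw [hD, hK, inner_add_left, inner_smul_left, conj_trivial]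
      nlinarith
    exact nonneg_of_mul_nonneg_right h3 hτ
  have hD0 := nonneg_of_forall_add_mul_nonneg key
  linarith

/-- A Lagrange multiplier for the composite problem with a sublinear second term. -/
theorem exists_multiplier_of_sublinear [FiniteDimensional ℝ F] (A : E →ₗ[ℝ] F)
    (hA : Function.Injective A) {g : F → ℝ} (g_hom : ∀ c : ℝ, 0 < c → ∀ v, g (c • v) = c * g v)
    (g_add : ∀ u v, g (u + v) ≤ g u + g v) (G : E →ₗ[ℝ] ℝ) (x : E)
    (h : ∀ x', g (A x) ≤ G (x' - x) + g (A x')) :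
    ∃ Y : F, (∀ d, G d + inner ℝ Y (A d) = 0) ∧
      ∀ v, g (A x) + inner ℝ Y (v - A x) ≤ g v := by
  have g_zero : g 0 = 0 := by
    have := g_hom 2 two_pos 0
    rw [smul_zero] at this
    linarith
  let φ : F →ₗ.[ℝ] ℝ :=
    ⟨LinearMap.range A, -G ∘ₗ (LinearEquiv.ofInjective A hA).symm.toLinearMap⟩
  have hφ : ∀ (d : E) (hd : A d ∈ LinearMap.range A), φ ⟨A d, hd⟩ = -G d := by
    intro d hd
    have : (LinearEquiv.ofInjective A hA).symm ⟨A d, hd⟩ = d := by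
      rw [LinearEquiv.symm_apply_eq]; rfl
    change -(G ((LinearEquiv.ofInjective A hA).symm ⟨A d, hd⟩)) = _
    rw [this]
  obtain ⟨ψ, hψ, hψg⟩ := exists_extension_of_le_sublinear φ g g_hom g_add (by
    rintro ⟨_, d, rfl⟩
    refine (hφ d ⟨d, rfl⟩).trans_le ?_
    change -G d ≤ g (A d)
    have h1 := h (x + d)
    rw [add_sub_cancel_left, map_add] at h1
    linarith [g_add (A x) (A d)])
  have hψA : ∀ d, ψ (A d) = -G d := fun d => by
    rw [← hφ d ⟨d, rfl⟩]; exact hψ ⟨A d, ⟨d, rfl⟩⟩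
  have hY : ∀ v, inner ℝ ((InnerProductSpace.toDual ℝ F).symm (LinearMap.toContinuousLinearMap ψ)) v
      = ψ v := fun v => by
    rw [InnerProductSpace.toDual_symm_apply]; rfl
  refine ⟨(InnerProductSpace.toDual ℝ F).symm (LinearMap.toContinuousLinearMap ψ), ?_, ?_⟩
  · intro d
    rw [hY, hψA]; ring
  · intro v
    rw [hY, map_sub, hψA]
    have h0 := h 0
    rw [zero_sub, map_neg, map_zero, g_zero] at h0
    linarith [hψg v]

/-- The pair `(a, b)` produced by one sweep of the alternating minimization started at the
governing variable `x`, in terms of subgradient inequalities. -/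
def IsSweep (f : E → ℝ) (g : F → ℝ) (A : E →ₗ[ℝ] F) (σ : ℝ) (x : F) (a : E) (b : F) : Prop :=
  (∀ a', f a - inner ℝ (x + σ • A a) (A a' - A a) ≤ f a') ∧
  ∀ b', g b + inner ℝ (x + (2 * σ) • A a - σ • b) (b' - b) ≤ g b'

theorem IsSweep.inner_le {f : E → ℝ} {g : F → ℝ} {A : E →ₗ[ℝ] F} {σ : ℝ} {x₁ x₂ : F} {a₁ a₂ : E}
    {b₁ b₂ : F} (h₁ : IsSweep f g A σ x₁ a₁ b₁) (h₂ : IsSweep f g A σ x₂ a₂ b₂) :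
    inner ℝ (x₁ - x₂) (A a₁ - A a₂) + σ * ‖A a₁ - A a₂‖ ^ 2 ≤ 0 ∧
    σ * ‖b₁ - b₂‖ ^ 2 ≤ inner ℝ ((x₁ - x₂) + (2 * σ) • (A a₁ - A a₂)) (b₁ - b₂) := by
  have p1 := h₁.1 a₂
  have p2 := h₂.1 a₁
  have q1 := h₁.2 b₂
  have q2 := h₂.2 b₁
  simp only [← real_inner_self_eq_norm_sq, inner_sub_left, inner_add_left, inner_sub_right,
    inner_smul_left, conj_trivial] at p1 p2 q1 q2 ⊢
  constructor
  · linarith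
  · linarith

theorem IsSweep.norm_reflect_le {f : E → ℝ} {g : F → ℝ} {A : E →ₗ[ℝ] F} {σ : ℝ} (hσ : 0 < σ)
    {x₁ x₂ : F} {a₁ a₂ : E} {b₁ b₂ : F} (h₁ : IsSweep f g A σ x₁ a₁ b₁)
    (h₂ : IsSweep f g A σ x₂ a₂ b₂) :
    ‖(x₁ + (2 * σ) • (A a₁ - b₁)) - (x₂ + (2 * σ) • (A a₂ - b₂))‖ ≤ ‖x₁ - x₂‖ := by
  obtain ⟨h1, h2⟩ := h₁.inner_le h₂
  refine le_of_sq_le_sq ?_ (norm_nonneg _)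
  have e : (x₁ + (2 * σ) • (A a₁ - b₁)) - (x₂ + (2 * σ) • (A a₂ - b₂))
      = (x₁ - x₂) + (2 * σ) • ((A a₁ - A a₂) - (b₁ - b₂)) := by module
  rw [e]
  generalize x₁ - x₂ = x at *
  generalize A a₁ - A a₂ = u at *
  generalize b₁ - b₂ = v at *
  rw [@norm_add_sq_real, norm_smul, mul_pow, @norm_sub_sq_real, inner_smul_right, inner_sub_right,
    Real.norm_of_nonneg (by positivity)]
  rw [inner_add_left, inner_smul_left, conj_trivial] at h2
  nlinarith

theorem IsSweep.norm_sub_le {f : E → ℝ} {g : F → ℝ} {A : E →ₗ[ℝ] F} {σ : ℝ} (hσ : 0 < σ)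
    {x₁ x₂ : F} {a₁ a₂ : E} {b₁ b₂ : F} (h₁ : IsSweep f g A σ x₁ a₁ b₁)
    (h₂ : IsSweep f g A σ x₂ a₂ b₂) :
    σ * ‖A a₁ - A a₂‖ ≤ ‖x₁ - x₂‖ ∧ σ * ‖b₁ - b₂‖ ≤ 3 * ‖x₁ - x₂‖ := by
  obtain ⟨h1, h2⟩ := h₁.inner_le h₂
  generalize x₁ - x₂ = x at *
  generalize A a₁ - A a₂ = u at *
  generalize b₁ - b₂ = v at *
  have hu : σ * ‖u‖ ≤ ‖x‖ := by
    have := neg_le_of_abs_le (abs_real_inner_le_norm x u)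
    rcases (norm_nonneg u).eq_or_lt with h0 | h0
    · rw [← h0, mul_zero]; exact norm_nonneg _
    · exact le_of_mul_le_mul_right (by nlinarith) h0
  refine ⟨hu, ?_⟩
  have h3 := h2.trans (real_inner_le_norm _ _)
  have h4 : ‖x + (2 * σ) • u‖ ≤ 3 * ‖x‖ := by
    refine (norm_add_le _ _).trans ?_
    rw [norm_smul, Real.norm_of_nonneg (by positivity)]
    linarith
  rcases (norm_nonneg v).eq_or_lt with h0 | h0
  · rw [← h0, mul_zero]; positivity
  · refine le_of_mul_le_mul_right ?_ h0
    nlinarith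

/-- Convergence of the Halpern Peaceman–Rachford method for `min f a + g (A a)`, `f` quadratic and
`g` sublinear. The map `G a` is the derivative of `f` at `a`. -/
theorem exists_tendsto_halpern_peacemanRachford [FiniteDimensional ℝ F]
    {f : E → ℝ} {g : F → ℝ} (A : E →ₗ[ℝ] F)
    (hA : Function.Injective A) (G : E → E →ₗ[ℝ] ℝ) {C : E → ℝ} (hC : ∀ d, 0 ≤ C d)
    (hf : ∀ a d (τ : ℝ), f (a + τ • d) = f a + τ * G a d + τ ^ 2 * C d)
    (g_hom : ∀ c : ℝ, 0 < c → ∀ v, g (c • v) = c * g v)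
    (g_add : ∀ u v, g (u + v) ≤ g u + g v) {σ : ℝ} (hσ : 0 < σ)
    (hopt : ∃ a, ∀ a', f a + g (A a) ≤ f a' + g (A a'))
    {L : E → F → F → ℝ} (hL : ∀ a v Y, L a v Y
      = f a + g v + inner ℝ Y (A a - v) + σ / 2 * ‖A a - v‖ ^ 2)
    (hmin₁ : ∀ v Y, ∃ a, ∀ a', L a v Y ≤ L a' v Y)
    (hmin₂ : ∀ a Y, ∃ v, ∀ v', L a v Y ≤ L a v' Y)
    {a : ℕ → E} {v Y v' Y' : ℕ → F}
    (step₁ : ∀ k a', L (a (k + 1)) (v k) (Y k) ≤ L a' (v k) (Y k))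
    (step₂ : ∀ k, Y' (k + 1) = Y k + σ • (A (a (k + 1)) - v k))
    (step₃ : ∀ k w, L (a (k + 1)) (v' (k + 1)) (Y' (k + 1)) ≤ L (a (k + 1)) w (Y' (k + 1)))
    (avg_v : ∀ k : ℕ, v (k + 1) = (1 / ((k : ℝ) + 2)) • v 0
      + (((k : ℝ) + 1) / ((k : ℝ) + 2)) • ((2 : ℝ) • v' (k + 1) - v k))
    (avg_Y : ∀ k : ℕ, Y (k + 1) = (1 / ((k : ℝ) + 2)) • Y 0
      + (((k : ℝ) + 1) / ((k : ℝ) + 2)) • ((2 : ℝ) • Y' (k + 1) - Y k)) :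
    ∃ (as : E) (Ys : F), Tendsto (fun k => A (a k)) atTop (nhds (A as)) ∧
      Tendsto v' atTop (nhds (A as)) ∧ Tendsto Y' atTop (nhds Ys) ∧
      (∀ d, G as d + inner ℝ Ys (A d) = 0) ∧
      (∀ w, g (A as) + inner ℝ Ys (w - A as) ≤ g w) ∧
      ∀ a', f as + g (A as) ≤ f a' + g (A a') := by
  have hfG : ∀ a a', f a + G a (a' - a) ≤ f a' := by
    intro a a'
    have := hf a (a' - a) 1
    rw [one_smul, add_sub_cancel] at this
    linarith [hC (a' - a)]
  have hfconv : ∀ x x' : E, ∃ c, ∀ τ : ℝ, 0 < τ → τ ≤ 1 →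
      f (x + τ • (x' - x)) ≤ f x + τ * (f x' - f x) + τ ^ 2 * c := by
    refine fun x x' => ⟨C (x' - x), fun τ hτ _ => ?_⟩
    rw [hf]
    nlinarith [hfG x x']
  have hgconv : ∀ x x' : F, ∃ c, ∀ τ : ℝ, 0 < τ → τ ≤ 1 →
      g (x + τ • (x' - x)) ≤ g x + τ * (g x' - g x) + τ ^ 2 * c := by
    refine fun x x' => ⟨0, fun τ hτ hτ1 => ?_⟩
    rcases hτ1.eq_or_lt with rfl | hlt
    · simp
    · have h1 := g_add ((1 - τ) • x) (τ • x')
      rw [g_hom _ (by linarith), g_hom _ hτ,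
        show (1 - τ) • x + τ • x' = x + τ • (x' - x) by module] at h1
      linarith
  have sweep : ∀ (w Z : F) (b : E) (c : F), (∀ a', L b w Z ≤ L a' w Z) →
      (∀ w', L b c (Z + σ • (A b - w)) ≤ L b w' (Z + σ • (A b - w))) →
      IsSweep f g A σ (Z - σ • w) b c := by
    intro w Z b c h1 h2
    simp only [hL] at h1 h2
    constructor
    · intro a'
      have := subgradient_of_isMin_penalized hfconv A Z w σ (x := b)
        (fun x' => by linarith [h1 x']) a'
      rw [map_sub, show Z + σ • (A b - w) = Z - σ • w + σ • A b by module] at this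
      exact this
    · intro b'
      have := subgradient_of_isMin_penalized hgconv LinearMap.id (-(Z + σ • (A b - w))) (A b) σ
        (x := c) (fun x' => by
          have h3 := h2 x'
          rw [← neg_sub c (A b), ← neg_sub x' (A b), norm_neg, norm_neg, inner_neg_right,
            inner_neg_right] at h3
          simp only [LinearMap.id_apply, inner_neg_left]
          linarith) b'
      rw [LinearMap.id_apply, LinearMap.id_apply,
        show -(Z + σ • (A b - w)) + σ • (c - A b)
          = -(Z - σ • w + (2 * σ) • A b - σ • c) by module, inner_neg_left] at this
      linarith
  have hex : ∀ x : F, ∃ bc : E × F, IsSweep f g A σ x bc.1 bc.2 := by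
    intro x
    obtain ⟨b, hb⟩ := hmin₁ 0 x
    obtain ⟨c, hc⟩ := hmin₂ b (x + σ • (A b - 0))
    exact ⟨(b, c), by simpa using sweep 0 x b c hb hc⟩
  choose s hs using hex
  obtain ⟨ao, hao⟩ := hopt
  obtain ⟨Yo, hYo, hgo⟩ := exists_multiplier_of_sublinear A hA g_hom g_add (G ao) ao (by
    intro a'
    obtain ⟨c, hc⟩ := hgconv (A ao) (A a')
    have key : ∀ τ : ℝ, 0 < τ → τ ≤ 1 →
        0 ≤ (G ao (a' - ao) + g (A a') - g (A ao)) + τ * (C (a' - ao) + c) := by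
      intro τ hτ hτ1
      have h1 := hao (ao + τ • (a' - ao))
      have h2 := hc τ hτ hτ1
      rw [hf, map_add A, map_smul A, map_sub A] at h1
      exact nonneg_of_mul_nonneg_right (by nlinarith : 0 ≤ τ * _) hτ
    linarith [nonneg_of_forall_add_mul_nonneg key])
  have hsw : ∀ k, IsSweep f g A σ (Y k - σ • v k) (a (k + 1)) (v' (k + 1)) := fun k =>
    sweep _ _ _ _ (step₁ k) fun w' => by simpa only [step₂] using step₃ k w'
  have hso : IsSweep f g A σ (Yo - σ • A ao) ao (A ao) := by
    constructor
    · intro a'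
      have h1 := hYo (a' - ao)
      rw [sub_add_cancel, ← map_sub]
      linarith [hfG ao a']
    · intro b'
      rw [show Yo - σ • A ao + (2 * σ) • A ao - σ • A ao = Yo by module]
      exact hgo b'
  have uniq : ∀ {x : F} {b₁ b₂ : E} {c₁ c₂ : F}, IsSweep f g A σ x b₁ c₁ →
      IsSweep f g A σ x b₂ c₂ → A b₁ = A b₂ ∧ c₁ = c₂ := by
    intro x b₁ b₂ c₁ c₂ h1 h2
    obtain ⟨h3, h4⟩ := h1.norm_sub_le hσ h2
    rw [sub_self, norm_zero] at h3 h4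
    constructor
    · exact sub_eq_zero.1 (norm_le_zero_iff.1 (by nlinarith [norm_nonneg (A b₁ - A b₂)]))
    · exact sub_eq_zero.1 (norm_le_zero_iff.1 (by nlinarith [norm_nonneg (c₁ - c₂)]))
  obtain ⟨p, hp, hlim⟩ := exists_tendsto_halpern
    (R := fun x => x + (2 * σ) • (A (s x).1 - (s x).2))
    (fun x y => (hs x).norm_reflect_le hσ (hs y)) (x := fun k => Y k - σ • v k) (by
      intro k
      obtain ⟨e1, e2⟩ := uniq (hs (Y k - σ • v k)) (hsw k)
      simp only [e1, e2]
      rw [avg_v, avg_Y, step₂]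
      module) ⟨Yo - σ • A ao, by
      obtain ⟨e1, e2⟩ := uniq (hs (Yo - σ • A ao)) hso
      simp only [e1, e2, sub_self, smul_zero, add_zero]⟩
  have hps := hs p
  have hAp : (s p).2 = A (s p).1 := by
    have h1 : (2 * σ) • (A (s p).1 - (s p).2) = 0 := by simpa using hp
    rcases smul_eq_zero.1 h1 with h | h
    · linarith
    · exact (sub_eq_zero.1 h).symm
  have hnorm : Tendsto (fun k => ‖(Y k - σ • v k) - p‖) atTop (nhds 0) :=
    tendsto_iff_norm_sub_tendsto_zero.1 hlim
  have hlimA : Tendsto (fun k => A (a (k + 1))) atTop (nhds (A (s p).1)) := by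
    rw [tendsto_iff_norm_sub_tendsto_zero]
    refine squeeze_zero (fun _ => norm_nonneg _) (fun k => ?_)
      (by simpa using hnorm.const_mul σ⁻¹)
    rw [← div_eq_inv_mul, le_div_iff₀' hσ]
    exact ((hsw k).norm_sub_le hσ hps).1
  have hlimv : Tendsto (fun k => v' (k + 1)) atTop (nhds (A (s p).1)) := by
    rw [← hAp, tendsto_iff_norm_sub_tendsto_zero]
    refine squeeze_zero (fun _ => norm_nonneg _) (fun k => ?_)
      (by simpa using (hnorm.const_mul 3).const_mul σ⁻¹)
    rw [← div_eq_inv_mul, le_div_iff₀' hσ]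
    exact ((hsw k).norm_sub_le hσ hps).2
  have hlimY : Tendsto (fun k => Y' (k + 1)) atTop (nhds (p + σ • A (s p).1)) := by
    refine (hlim.add (hlimA.const_smul σ)).congr fun k => ?_
    rw [step₂]
    module
  have hf' : ∀ a', f (s p).1 - inner ℝ (p + σ • A (s p).1) (A a' - A (s p).1) ≤ f a' := hps.1
  have hg' : ∀ w, g (A (s p).1) + inner ℝ (p + σ • A (s p).1) (w - A (s p).1) ≤ g w := by
    intro w
    have := hps.2 w
    rwa [hAp, show p + (2 * σ) • A (s p).1 - σ • A (s p).1 = p + σ • A (s p).1 by module] at this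
  refine ⟨(s p).1, p + σ • A (s p).1, (tendsto_add_atTop_iff_nat 1).1 hlimA,
    (tendsto_add_atTop_iff_nat 1).1 hlimv, (tendsto_add_atTop_iff_nat 1).1 hlimY, ?_, hg',
    fun a' => by linarith [hf' a', hg' (A a')]⟩
  have hnonneg : ∀ d, 0 ≤ G (s p).1 d + inner ℝ (p + σ • A (s p).1) (A d) := by
    refine fun d => nonneg_of_forall_add_mul_nonneg (K := C d) fun τ hτ _ => ?_
    have h1 := hf' ((s p).1 + τ • d)
    rw [hf, map_add A, map_smul A, add_sub_cancel_left, inner_smul_right] at h1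
    exact nonneg_of_mul_nonneg_right (by nlinarith : 0 ≤ τ * _) hτ
  intro d
  have h1 := hnonneg (-d)
  rw [map_neg, map_neg, inner_neg_right] at h1
  linarith [hnonneg d]

end Splitting

section Frobenius

variable {a b c m : ℕ}

theorem frob_eq_trace (A B : Matrix (Fin a) (Fin b) ℝ) : frob A B = (Aᵀ * B).trace := by
  simp only [frob, Matrix.trace, Matrix.diag, Matrix.mul_apply, Matrix.transpose_apply]
  exact Finset.sum_comm

theorem frob_add_left (A A' B : Matrix (Fin a) (Fin b) ℝ) :
    frob (A + A') B = frob A B + frob A' B := by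
  simp [frob_eq_trace, Matrix.add_mul]

theorem frob_add_right (A B B' : Matrix (Fin a) (Fin b) ℝ) :
    frob A (B + B') = frob A B + frob A B' := by
  simp [frob_eq_trace, Matrix.mul_add]

theorem frob_smul_left (τ : ℝ) (A B : Matrix (Fin a) (Fin b) ℝ) :
    frob (τ • A) B = τ * frob A B := by
  simp [frob_eq_trace]

theorem frob_smul_right (τ : ℝ) (A B : Matrix (Fin a) (Fin b) ℝ) :
    frob A (τ • B) = τ * frob A B := by
  simp [frob_eq_trace]

theorem frob_sum_left {κ : Type*} (K : Finset κ) (A : κ → Matrix (Fin a) (Fin b) ℝ)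
    (B : Matrix (Fin a) (Fin b) ℝ) : frob (∑ k ∈ K, A k) B = ∑ k ∈ K, frob (A k) B := by
  simp [frob_eq_trace, Matrix.transpose_sum, Matrix.sum_mul, Matrix.trace_sum]

theorem frob_mul_left_adjoint (S : Matrix (Fin a) (Fin c) ℝ) (P : Matrix (Fin a) (Fin b) ℝ)
    (D : Matrix (Fin b) (Fin c) ℝ) : frob S (P * D) = frob (Pᵀ * S) D := by
  simp [frob_eq_trace, Matrix.mul_assoc]

theorem frob_mul_right_adjoint (T : Matrix (Fin a) (Fin c) ℝ) (D : Matrix (Fin a) (Fin b) ℝ)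
    (B : Matrix (Fin b) (Fin c) ℝ) : frob T (D * B) = frob (T * Bᵀ) D := by
  rw [frob_eq_trace, frob_eq_trace, Matrix.transpose_mul, Matrix.transpose_transpose,
    ← Matrix.mul_assoc, Matrix.trace_mul_comm, Matrix.mul_assoc]

theorem ipF_self_eq_zero {A : Fin m → Matrix (Fin a) (Fin b) ℝ} (h : ipF A A = 0) : A = 0 := by
  simp only [ipF, frob] at h
  ext r i j
  have h1 := (Finset.sum_eq_zero_iff_of_nonneg fun r _ => Finset.sum_nonneg fun i _ =>
    Finset.sum_nonneg fun j _ => mul_self_nonneg (A r i j)).1 h r (Finset.mem_univ r)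
  have h2 := (Finset.sum_eq_zero_iff_of_nonneg fun i _ => Finset.sum_nonneg fun j _ =>
    mul_self_nonneg (A r i j)).1 h1 i (Finset.mem_univ i)
  exact mul_self_eq_zero.1 ((Finset.sum_eq_zero_iff_of_nonneg fun j _ =>
    mul_self_nonneg (A r i j)).1 h2 j (Finset.mem_univ j))

/-- Pairing with a fixed family, as a linear form. -/
noncomputable def ipFLinear (A : Fin m → Matrix (Fin a) (Fin b) ℝ) :
    (Fin m → Matrix (Fin a) (Fin b) ℝ) →ₗ[ℝ] ℝ where
  toFun B := ipF A B
  map_add' B B' := by simp [ipF, frob_add_right, Finset.sum_add_distrib]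
  map_smul' τ B := by simp [ipF, frob_smul_right, Finset.mul_sum]

end Frobenius

section Regularizers

theorem lpNorm_smul {d : ℕ} {p : ℝ} (hp : 1 ≤ p) {c : ℝ} (hc : 0 < c) (x : Fin d → ℝ) :
    lpNorm p (c • x) = c * lpNorm p x := by
  have hp0 : p ≠ 0 := by linarith
  simp only [lpNorm, Pi.smul_apply, smul_eq_mul, abs_mul, abs_of_pos hc]
  simp_rw [Real.mul_rpow hc.le (abs_nonneg _)]
  rw [← Finset.mul_sum, Real.mul_rpow (by positivity) (by positivity), ← Real.rpow_mul hc.le,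
    mul_one_div_cancel hp0, Real.rpow_one]

theorem lpNorm_add_le {d : ℕ} {p : ℝ} (hp : 1 ≤ p) (x y : Fin d → ℝ) :
    lpNorm p (x + y) ≤ lpNorm p x + lpNorm p y :=
  Real.Lp_add_le Finset.univ x y hp

theorem l2_eq_norm {d : ℕ} (x : Fin d → ℝ) : l2 x = ‖(WithLp.toLp 2 x : EuclideanSpace ℝ (Fin d))‖ := by
  simp [l2, EuclideanSpace.norm_eq]

theorem OmegaF_smul {d s m : ℕ} (lamt : ℝ) {p : ℝ} (hp : 1 ≤ p) {c : ℝ} (hc : 0 < c)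
    (W : Fin m → Matrix (Fin d) (Fin s) ℝ) :
    OmegaF d s m lamt p (c • W) = c * OmegaF d s m lamt p W := by
  have h : ∀ r i, lpNorm p (fun j => (c • W) r i j) = c * lpNorm p (fun j => W r i j) :=
    fun r i => lpNorm_smul hp hc fun j => W r i j
  simp only [OmegaF, h, ← Finset.mul_sum]
  ring

theorem OmegaF_add_le {d s m : ℕ} {lamt p : ℝ} (hlamt : 0 ≤ lamt) (hp : 1 ≤ p)
    (W W' : Fin m → Matrix (Fin d) (Fin s) ℝ) :
    OmegaF d s m lamt p (W + W') ≤ OmegaF d s m lamt p W + OmegaF d s m lamt p W' := by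
  simp only [OmegaF, ← mul_add, ← Finset.sum_add_distrib]
  gcongr with r _ i _
  exact lpNorm_add_le hp (fun j => W r i j) fun j => W' r i j

theorem PhiF_smul {t e m s : ℕ} (lamg : ℝ) {q : ℝ} (hq : 1 ≤ q) (E : Finset (Fin s × Fin s))
    (w : Fin s × Fin s → ℝ) (ι : {x // x ∈ E} ≃ Fin e) {c : ℝ} (hc : 0 < c)
    (Z : Fin m → Matrix (Fin t) (Fin e) ℝ) :
    PhiF t e m s lamg q E w ι (c • Z) = c * PhiF t e m s lamg q E w ι Z := by
  have h : ∀ r (a : {x // x ∈ E}), w a.1 * lpNorm q (fun i => (c • Z) r i (ι a))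
      = c * (w a.1 * lpNorm q (fun i => Z r i (ι a))) := fun r a => by
    rw [mul_left_comm]
    exact congrArg (w a.1 * ·) (lpNorm_smul hq hc fun i => Z r i (ι a))
  simp only [PhiF, h, ← Finset.mul_sum]
  ring

theorem PhiF_add_le {t e m s : ℕ} {lamg q : ℝ} (hlamg : 0 ≤ lamg) (hq : 1 ≤ q)
    {E : Finset (Fin s × Fin s)} {w : Fin s × Fin s → ℝ} (hw : ∀ x ∈ E, 0 ≤ w x)
    (ι : {x // x ∈ E} ≃ Fin e) (Z Z' : Fin m → Matrix (Fin t) (Fin e) ℝ) :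
    PhiF t e m s lamg q E w ι (Z + Z')
      ≤ PhiF t e m s lamg q E w ι Z + PhiF t e m s lamg q E w ι Z' := by
  simp only [PhiF, ← mul_add, ← Finset.sum_add_distrib]
  gcongr with r _ a _
  · exact hw _ a.2
  · exact lpNorm_add_le hq (fun i => Z r i (ι a)) fun i => Z' r i (ι a)

theorem PsiF_smul {t s m : ℕ} (lam1 lam2 : ℝ) {c : ℝ} (hc : 0 < c)
    (U : Fin m → Matrix (Fin t) (Fin s) ℝ) :
    PsiF t s m lam1 lam2 (c • U) = c * PsiF t s m lam1 lam2 U := by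
  have h1 : ∀ i j, l1 (fun r => (c • U) r i j) = c * l1 (fun r => U r i j) := fun i j => by
    simp [l1, abs_mul, abs_of_pos hc, Finset.mul_sum]
  have h2 : ∀ i j, l2 (fun r => (c • U) r i j) = c * l2 (fun r => U r i j) := fun i j => by
    rw [l2_eq_norm, l2_eq_norm]
    change ‖c • (WithLp.toLp 2 fun r => U r i j : EuclideanSpace ℝ (Fin m))‖ = _
    rw [norm_smul, Real.norm_of_nonneg hc.le]
  simp only [PsiF, h1, h2, Finset.mul_sum]
  refine Finset.sum_congr rfl fun i _ => Finset.sum_congr rfl fun j _ => ?_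
  ring

theorem PsiF_add_le {t s m : ℕ} {lam1 lam2 : ℝ} (hlam1 : 0 ≤ lam1) (hlam2 : 0 ≤ lam2)
    (U U' : Fin m → Matrix (Fin t) (Fin s) ℝ) :
    PsiF t s m lam1 lam2 (U + U') ≤ PsiF t s m lam1 lam2 U + PsiF t s m lam1 lam2 U' := by
  simp only [PsiF, ← Finset.sum_add_distrib]
  refine Finset.sum_le_sum fun i _ => Finset.sum_le_sum fun j _ => ?_
  have h1 : l1 (fun r => (U + U') r i j) ≤ l1 (fun r => U r i j) + l1 (fun r => U' r i j) := by
    simp only [l1, ← Finset.sum_add_distrib]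
    exact Finset.sum_le_sum fun r _ => abs_add_le _ _
  have h2 : l2 (fun r => (U + U') r i j) ≤ l2 (fun r => U r i j) + l2 (fun r => U' r i j) := by
    simp only [l2_eq_norm]
    exact norm_add_le (WithLp.toLp 2 fun r => U r i j : EuclideanSpace ℝ (Fin m))
      (WithLp.toLp 2 fun r => U' r i j)
  nlinarith [mul_le_mul_of_nonneg_left h1 hlam1, mul_le_mul_of_nonneg_left h2 hlam2]

end Regularizers

section Loss

variable {t s n m : ℕ}

/-- The gradient of the squared loss. -/
noncomputable def lossGrad (X : Fin n → Matrix (Fin t) (Fin s) ℝ) (y : Fin m → Fin n → ℝ)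
    (Θ : Fin m → Matrix (Fin t) (Fin s) ℝ) : Fin m → Matrix (Fin t) (Fin s) ℝ :=
  fun r => ∑ k, (frob (X k) (Θ r) - y r k) • X k

theorem lossF_add_smul (X : Fin n → Matrix (Fin t) (Fin s) ℝ) (y : Fin m → Fin n → ℝ)
    (Θ D : Fin m → Matrix (Fin t) (Fin s) ℝ) (τ : ℝ) :
    lossF t s n m X y (Θ + τ • D) = lossF t s n m X y Θ + τ * ipF (lossGrad X y Θ) D
      + τ ^ 2 * ((1 / 2) * ∑ r, ∑ k, frob (X k) (D r) ^ 2) := by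
  simp only [lossF, ipF, lossGrad, frob_sum_left, frob_smul_left, Pi.add_apply, Pi.smul_apply,
    frob_add_right, frob_smul_right, Finset.mul_sum, ← Finset.sum_add_distrib]
  refine Finset.sum_congr rfl fun r _ => Finset.sum_congr rfl fun k _ => ?_
  ring

end Loss

section Packing

variable {d t s e m : ℕ}

/-- Triples of matrix families, as a Euclidean space for the sum of the Frobenius inner products. -/
abbrev TripleSpace (d t s e m : ℕ) : Type :=
  EuclideanSpace ℝ ((Fin m × Fin d × Fin s) ⊕ (Fin m × Fin t × Fin e) ⊕ (Fin m × Fin t × Fin s))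

/-- The identification of triples of matrix families with `TripleSpace`. -/
noncomputable def packTriple : ((Fin m → Matrix (Fin d) (Fin s) ℝ) × (Fin m → Matrix (Fin t) (Fin e) ℝ)
    × (Fin m → Matrix (Fin t) (Fin s) ℝ)) ≃ₗ[ℝ] TripleSpace d t s e m where
  toFun x := WithLp.toLp 2 (Sum.elim (fun i => x.1 i.1 i.2.1 i.2.2)
    (Sum.elim (fun i => x.2.1 i.1 i.2.1 i.2.2) fun i => x.2.2 i.1 i.2.1 i.2.2))
  map_add' x y := by ext (i | i | i) <;> rfl
  map_smul' c x := by ext (i | i | i) <;> rfl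
  invFun v := (fun r => Matrix.of fun i j => v (Sum.inl (r, i, j)),
    fun r => Matrix.of fun i j => v (Sum.inr (Sum.inl (r, i, j))),
    fun r => Matrix.of fun i j => v (Sum.inr (Sum.inr (r, i, j))))
  left_inv x := rfl
  right_inv v := by ext (i | i | i) <;> rfl

theorem inner_packTriple (x y : (Fin m → Matrix (Fin d) (Fin s) ℝ) × (Fin m → Matrix (Fin t) (Fin e) ℝ)
    × (Fin m → Matrix (Fin t) (Fin s) ℝ)) :
    inner ℝ (packTriple x) (packTriple y)
      = ipF x.1 y.1 + ipF x.2.1 y.2.1 + ipF x.2.2 y.2.2 := by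
  simp only [packTriple, PiLp.inner_apply, Fintype.sum_sum_type, Fintype.sum_prod_type, ipF, frob]
  rw [← add_assoc]
  refine congrArg₂ (· + ·) (congrArg₂ (· + ·) ?_ ?_) ?_ <;>
  exact Finset.sum_congr rfl fun r _ => Finset.sum_congr rfl fun i _ =>
    Finset.sum_congr rfl fun j _ => mul_comm _ _

theorem continuous_packTriple_symm :
    Continuous (packTriple (d := d) (t := t) (s := s) (e := e) (m := m)).symm := by
  refine Continuous.prodMk ?_ (Continuous.prodMk ?_ ?_) <;>
  · refine continuous_pi fun r => continuous_pi fun i => continuous_pi fun j => ?_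
    exact PiLp.continuous_apply 2 _ _

/-- The constraint map `Θ ↦ (P Θ, Θ B, Θ)`. -/
noncomputable def constraintMap (m : ℕ) (P : Matrix (Fin d) (Fin t) ℝ) (B : Matrix (Fin s) (Fin e) ℝ) :
    (Fin m → Matrix (Fin t) (Fin s) ℝ) →ₗ[ℝ] (Fin m → Matrix (Fin d) (Fin s) ℝ)
      × (Fin m → Matrix (Fin t) (Fin e) ℝ) × (Fin m → Matrix (Fin t) (Fin s) ℝ) where
  toFun Θ := (fun r => P * Θ r, fun r => Θ r * B, Θ)
  map_add' Θ Θ' := by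
    refine Prod.ext ?_ (Prod.ext ?_ rfl) <;> funext r
    · exact Matrix.mul_add _ _ _
    · exact Matrix.add_mul _ _ _
  map_smul' c Θ := by
    refine Prod.ext ?_ (Prod.ext ?_ rfl) <;> funext r
    · exact Matrix.mul_smul P c (Θ r)
    · exact Matrix.smul_mul c (Θ r) B

end Packing

theorem LagF_eq_inner {t s e n m : ℕ} (X : Fin n → Matrix (Fin t) (Fin s) ℝ)
    (y : Fin m → Fin n → ℝ) (lamt lamg lam1 lam2 p q : ℝ)
    (E : Finset (Fin s × Fin s)) (w : Fin s × Fin s → ℝ) (ι : {x // x ∈ E} ≃ Fin e)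
    (P : Matrix (Fin (t - 1)) (Fin t) ℝ) (B : Matrix (Fin s) (Fin e) ℝ) (σ : ℝ)
    (Θ : Fin m → Matrix (Fin t) (Fin s) ℝ)
    (x z : (Fin m → Matrix (Fin (t - 1)) (Fin s) ℝ) × (Fin m → Matrix (Fin t) (Fin e) ℝ)
      × (Fin m → Matrix (Fin t) (Fin s) ℝ)) :
    LagF t s e n m X y lamt lamg lam1 lam2 p q E w ι P B σ Θ x.1 x.2.1 x.2.2 z.1 z.2.1 z.2.2
      = lossF t s n m X y Θ + (OmegaF (t - 1) s m lamt p x.1 + PhiF t e m s lamg q E w ι x.2.1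
          + PsiF t s m lam1 lam2 x.2.2)
        + inner ℝ (packTriple z) (packTriple (constraintMap m P B Θ) - packTriple x)
        + σ / 2 * ‖packTriple (constraintMap m P B Θ) - packTriple x‖ ^ 2 := by
  rw [← map_sub, ← real_inner_self_eq_norm_sq, inner_packTriple, inner_packTriple]
  change objF t s e n m X y lamt lamg lam1 lam2 p q E w ι Θ x.1 x.2.1 x.2.2
    + ipF z.1 (fun r => P * Θ r - x.1 r) + ipF z.2.1 (fun r => Θ r * B - x.2.1 r)
    + ipF z.2.2 (fun r => Θ r - x.2.2 r)
    + (σ / 2) * (ipF (fun r => P * Θ r - x.1 r) (fun r => P * Θ r - x.1 r)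
        + ipF (fun r => Θ r * B - x.2.1 r) (fun r => Θ r * B - x.2.1 r)
        + ipF (fun r => Θ r - x.2.2 r) (fun r => Θ r - x.2.2 r))
    = lossF t s n m X y Θ + (OmegaF (t - 1) s m lamt p x.1 + PhiF t e m s lamg q E w ι x.2.1
          + PsiF t s m lam1 lam2 x.2.2)
      + (ipF z.1 (fun r => P * Θ r - x.1 r) + ipF z.2.1 (fun r => Θ r * B - x.2.1 r)
        + ipF z.2.2 (fun r => Θ r - x.2.2 r))
      + σ / 2 * (ipF (fun r => P * Θ r - x.1 r) (fun r => P * Θ r - x.1 r)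
        + ipF (fun r => Θ r * B - x.2.1 r) (fun r => Θ r * B - x.2.1 r)
        + ipF (fun r => Θ r - x.2.2 r) (fun r => Θ r - x.2.2 r))
  rw [objF]
  ring

theorem inner_packTriple_constraintMap {d t s e m : ℕ} (P : Matrix (Fin d) (Fin t) ℝ)
    (B : Matrix (Fin s) (Fin e) ℝ) (z : (Fin m → Matrix (Fin d) (Fin s) ℝ)
      × (Fin m → Matrix (Fin t) (Fin e) ℝ) × (Fin m → Matrix (Fin t) (Fin s) ℝ))
    (D : Fin m → Matrix (Fin t) (Fin s) ℝ) :
    inner ℝ (packTriple z) (packTriple (constraintMap m P B D))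
      = ipF (fun r => Pᵀ * z.1 r + z.2.1 r * Bᵀ + z.2.2 r) D := by
  rw [inner_packTriple]
  simp only [ipF, frob_add_left, Finset.sum_add_distrib, ← frob_mul_left_adjoint,
    ← frob_mul_right_adjoint]
  rfl

/-- Global convergence of the HPR method for the MultiGGFL splitting problem:
the sequence of barred iterates converges to a KKT point, whose primal part is an
optimal solution of the problem. -/
theorem hpr_global_convergence (t s e n m : ℕ)
    (X : Fin n → Matrix (Fin t) (Fin s) ℝ) (y : Fin m → Fin n → ℝ)
    (lamt lamg lam1 lam2 p q : ℝ)
    (hlamt : 0 < lamt) (hlamg : 0 < lamg) (hlam1 : 0 < lam1) (hlam2 : 0 ≤ lam2)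
    (hp : 1 ≤ p) (hq : 1 ≤ q)
    (E : Finset (Fin s × Fin s)) (w : Fin s × Fin s → ℝ) (hw : ∀ x ∈ E, 0 ≤ w x)
    (ι : {x // x ∈ E} ≃ Fin e)
    (P : Matrix (Fin (t - 1)) (Fin t) ℝ) (B : Matrix (Fin s) (Fin e) ℝ)
    (σ : ℝ) (hσ : 0 < σ)
    -- the unbarred iterates H_k
    (Θk Uk Rk : ℕ → Fin m → Matrix (Fin t) (Fin s) ℝ)
    (Wk Sk : ℕ → Fin m → Matrix (Fin (t - 1)) (Fin s) ℝ)
    (Zk Tk : ℕ → Fin m → Matrix (Fin t) (Fin e) ℝ)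
    -- the barred iterates H̄_k
    (Θb Ub Rb : ℕ → Fin m → Matrix (Fin t) (Fin s) ℝ)
    (Wb Sb : ℕ → Fin m → Matrix (Fin (t - 1)) (Fin s) ℝ)
    (Zb Tb : ℕ → Fin m → Matrix (Fin t) (Fin e) ℝ)
    -- the problem has an optimal solution
    (hopt : ∃ (Θo Uo : Fin m → Matrix (Fin t) (Fin s) ℝ)
      (Wo : Fin m → Matrix (Fin (t - 1)) (Fin s) ℝ)
      (Zo : Fin m → Matrix (Fin t) (Fin e) ℝ),
      (∀ r, P * Θo r = Wo r) ∧ (∀ r, Θo r * B = Zo r)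
      ∧ (∀ r, Θo r = Uo r) ∧
      ∀ (Θ' U' : Fin m → Matrix (Fin t) (Fin s) ℝ)
        (W' : Fin m → Matrix (Fin (t - 1)) (Fin s) ℝ)
        (Z' : Fin m → Matrix (Fin t) (Fin e) ℝ),
        (∀ r, P * Θ' r = W' r) → (∀ r, Θ' r * B = Z' r) →
        (∀ r, Θ' r = U' r) →
        objF t s e n m X y lamt lamg lam1 lam2 p q E w ι Θo Wo Zo Uo
          ≤ objF t s e n m X y lamt lamg lam1 lam2 p q E w ι Θ' W' Z' U')
    -- the Θ-subproblem has a unique minimizer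
    (huniqTheta : ∀ W Z U S T R, ∃! Θ',
      ∀ Θ'', LagF t s e n m X y lamt lamg lam1 lam2 p q E w ι P B σ Θ' W Z U S T R
        ≤ LagF t s e n m X y lamt lamg lam1 lam2 p q E w ι P B σ Θ'' W Z U S T R)
    -- the (W, Z, U)-subproblem has a unique minimizer
    (huniqWZU : ∀ Θ' S T R, ∃! x : (Fin m → Matrix (Fin (t - 1)) (Fin s) ℝ)
        × (Fin m → Matrix (Fin t) (Fin e) ℝ) × (Fin m → Matrix (Fin t) (Fin s) ℝ),
      ∀ x' : (Fin m → Matrix (Fin (t - 1)) (Fin s) ℝ)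
        × (Fin m → Matrix (Fin t) (Fin e) ℝ) × (Fin m → Matrix (Fin t) (Fin s) ℝ),
        LagF t s e n m X y lamt lamg lam1 lam2 p q E w ι P B σ Θ' x.1 x.2.1 x.2.2 S T R
          ≤ LagF t s e n m X y lamt lamg lam1 lam2 p q E w ι P B σ Θ' x'.1 x'.2.1 x'.2.2 S T R)
    -- Step 1: Θ̄_{k+1} minimizes the augmented Lagrangian in Θ
    (hstep1 : ∀ k Θ',
      LagF t s e n m X y lamt lamg lam1 lam2 p q E w ι P B σ
          (Θb (k + 1)) (Wk k) (Zk k) (Uk k) (Sk k) (Tk k) (Rk k)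
        ≤ LagF t s e n m X y lamt lamg lam1 lam2 p q E w ι P B σ
          Θ' (Wk k) (Zk k) (Uk k) (Sk k) (Tk k) (Rk k))
    -- Step 2: multiplier updates
    (hstep2S : ∀ k, Sb (k + 1) = fun r => Sk k r + σ • (P * Θb (k + 1) r - Wk k r))
    (hstep2T : ∀ k, Tb (k + 1) = fun r => Tk k r + σ • (Θb (k + 1) r * B - Zk k r))
    (hstep2R : ∀ k, Rb (k + 1) = fun r => Rk k r + σ • (Θb (k + 1) r - Uk k r))
    -- Step 3: (W̄, Z̄, Ū)_{k+1} minimizes the augmented Lagrangian in (W, Z, U)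
    (hstep3 : ∀ k W' Z' U',
      LagF t s e n m X y lamt lamg lam1 lam2 p q E w ι P B σ
          (Θb (k + 1)) (Wb (k + 1)) (Zb (k + 1)) (Ub (k + 1))
          (Sb (k + 1)) (Tb (k + 1)) (Rb (k + 1))
        ≤ LagF t s e n m X y lamt lamg lam1 lam2 p q E w ι P B σ
          (Θb (k + 1)) W' Z' U' (Sb (k + 1)) (Tb (k + 1)) (Rb (k + 1)))
    -- Steps 4 and 5: extrapolation and Halpern averaging, H_{k+1} = (1/(k+2))H₀ + ((k+1)/(k+2))(2H̄_{k+1} − H_k)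
    (hstep45Θ : ∀ k, Θk (k + 1) = (1 / ((k : ℝ) + 2)) • Θk 0
      + (((k : ℝ) + 1) / ((k : ℝ) + 2)) • ((2 : ℝ) • Θb (k + 1) - Θk k))
    (hstep45W : ∀ k, Wk (k + 1) = (1 / ((k : ℝ) + 2)) • Wk 0
      + (((k : ℝ) + 1) / ((k : ℝ) + 2)) • ((2 : ℝ) • Wb (k + 1) - Wk k))
    (hstep45Z : ∀ k, Zk (k + 1) = (1 / ((k : ℝ) + 2)) • Zk 0
      + (((k : ℝ) + 1) / ((k : ℝ) + 2)) • ((2 : ℝ) • Zb (k + 1) - Zk k))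
    (hstep45U : ∀ k, Uk (k + 1) = (1 / ((k : ℝ) + 2)) • Uk 0
      + (((k : ℝ) + 1) / ((k : ℝ) + 2)) • ((2 : ℝ) • Ub (k + 1) - Uk k))
    (hstep45S : ∀ k, Sk (k + 1) = (1 / ((k : ℝ) + 2)) • Sk 0
      + (((k : ℝ) + 1) / ((k : ℝ) + 2)) • ((2 : ℝ) • Sb (k + 1) - Sk k))
    (hstep45T : ∀ k, Tk (k + 1) = (1 / ((k : ℝ) + 2)) • Tk 0
      + (((k : ℝ) + 1) / ((k : ℝ) + 2)) • ((2 : ℝ) • Tb (k + 1) - Tk k))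
    (hstep45R : ∀ k, Rk (k + 1) = (1 / ((k : ℝ) + 2)) • Rk 0
      + (((k : ℝ) + 1) / ((k : ℝ) + 2)) • ((2 : ℝ) • Rb (k + 1) - Rk k)) :
    ∃ (Θs Us Rs : Fin m → Matrix (Fin t) (Fin s) ℝ)
      (Ws Ss : Fin m → Matrix (Fin (t - 1)) (Fin s) ℝ)
      (Zs Ts : Fin m → Matrix (Fin t) (Fin e) ℝ),
      -- convergence of the barred iterates to H*
      Tendsto Θb atTop (nhds Θs) ∧ Tendsto Wb atTop (nhds Ws)
        ∧ Tendsto Zb atTop (nhds Zs) ∧ Tendsto Ub atTop (nhds Us)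
        ∧ Tendsto Sb atTop (nhds Ss) ∧ Tendsto Tb atTop (nhds Ts)
        ∧ Tendsto Rb atTop (nhds Rs)
      -- KKT: 0 = ∇ℓ(Θ*) + 𝒫*S* + 𝒬*T* + R*
      ∧ (∀ r, (∑ k, (frob (X k) (Θs r) - y r k) • X k)
            + Pᵀ * Ss r + Ts r * Bᵀ + Rs r = 0)
      -- KKT: S* ∈ ∂Ω(W*)
      ∧ (∀ W', OmegaF (t - 1) s m lamt p Ws + ipF Ss (fun r => W' r - Ws r)
            ≤ OmegaF (t - 1) s m lamt p W')
      -- KKT: T* ∈ ∂Φ(Z*)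
      ∧ (∀ Z', PhiF t e m s lamg q E w ι Zs + ipF Ts (fun r => Z' r - Zs r)
            ≤ PhiF t e m s lamg q E w ι Z')
      -- KKT: R* ∈ ∂Ψ(U*)
      ∧ (∀ U', PsiF t s m lam1 lam2 Us + ipF Rs (fun r => U' r - Us r)
            ≤ PsiF t s m lam1 lam2 U')
      -- KKT: primal feasibility
      ∧ (∀ r, P * Θs r = Ws r) ∧ (∀ r, Θs r * B = Zs r) ∧ (∀ r, Θs r = Us r)
      -- (Θ*, W*, Z*, U*) is an optimal solution
      ∧ (∀ (Θ' U' : Fin m → Matrix (Fin t) (Fin s) ℝ)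
          (W' : Fin m → Matrix (Fin (t - 1)) (Fin s) ℝ)
          (Z' : Fin m → Matrix (Fin t) (Fin e) ℝ),
          (∀ r, P * Θ' r = W' r) → (∀ r, Θ' r * B = Z' r) →
          (∀ r, Θ' r = U' r) →
          objF t s e n m X y lamt lamg lam1 lam2 p q E w ι Θs Ws Zs Us
            ≤ objF t s e n m X y lamt lamg lam1 lam2 p q E w ι Θ' W' Z' U') := by
  obtain ⟨Θo, Uo, Wo, Zo, hWo, hZo, hUo, hmin⟩ := hopt
  let A : (Fin m → Matrix (Fin t) (Fin s) ℝ) →ₗ[ℝ] TripleSpace (t - 1) t s e m :=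
    packTriple.toLinearMap ∘ₗ constraintMap m P B
  have hAdef : ∀ Θ, A Θ = packTriple (constraintMap m P B Θ) := fun _ => rfl
  have hA : Function.Injective A := fun Θ Θ' h =>
    congrArg (fun x => x.2.2) (packTriple.injective h)
  let g : TripleSpace (t - 1) t s e m → ℝ := fun v =>
    OmegaF (t - 1) s m lamt p (packTriple.symm v).1
      + PhiF t e m s lamg q E w ι (packTriple.symm v).2.1
      + PsiF t s m lam1 lam2 (packTriple.symm v).2.2
  have hg : ∀ x, g (packTriple x) = OmegaF (t - 1) s m lamt p x.1
      + PhiF t e m s lamg q E w ι x.2.1 + PsiF t s m lam1 lam2 x.2.2 := fun _ => rfl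
  have g_hom : ∀ c : ℝ, 0 < c → ∀ v, g (c • v) = c * g v := by
    intro c hc v
    simp only [g, map_smul, Prod.smul_fst, Prod.smul_snd, OmegaF_smul lamt hp hc,
      PhiF_smul lamg hq E w ι hc, PsiF_smul lam1 lam2 hc]
    ring
  have g_add : ∀ u v, g (u + v) ≤ g u + g v := by
    intro u v
    simp only [g, map_add, Prod.fst_add, Prod.snd_add]
    linarith [OmegaF_add_le hlamt.le hp (packTriple.symm u).1 (packTriple.symm v).1,
      PhiF_add_le hlamg.le hq hw ι (packTriple.symm u).2.1 (packTriple.symm v).2.1,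
      PsiF_add_le hlam1.le hlam2 (packTriple.symm u).2.2 (packTriple.symm v).2.2]
  let L : (Fin m → Matrix (Fin t) (Fin s) ℝ) → TripleSpace (t - 1) t s e m →
      TripleSpace (t - 1) t s e m → ℝ := fun Θ v Y =>
    LagF t s e n m X y lamt lamg lam1 lam2 p q E w ι P B σ Θ (packTriple.symm v).1
      (packTriple.symm v).2.1 (packTriple.symm v).2.2 (packTriple.symm Y).1
      (packTriple.symm Y).2.1 (packTriple.symm Y).2.2
  have hL : ∀ Θ v Y, L Θ v Y = lossF t s n m X y Θ + g v + inner ℝ Y (A Θ - v)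
      + σ / 2 * ‖A Θ - v‖ ^ 2 := by
    intro Θ v Y
    have := LagF_eq_inner X y lamt lamg lam1 lam2 p q E w ι P B σ Θ (packTriple.symm v)
      (packTriple.symm Y)
    rw [LinearEquiv.apply_symm_apply, LinearEquiv.apply_symm_apply] at this
    exact this
  obtain ⟨Θs, Ys, hlimA, hlimv, hlimY, hstat, hsub, hbest⟩ := exists_tendsto_halpern_peacemanRachford
    (f := lossF t s n m X y) (g := g) A hA (fun Θ => ipFLinear (lossGrad X y Θ))
    (C := fun D => (1 / 2) * ∑ r, ∑ k, frob (X k) (D r) ^ 2) (fun D => by positivity)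
    (fun Θ D τ => lossF_add_smul X y Θ D τ) g_hom g_add hσ
    ⟨Θo, fun Θ' => by
      have h1 := hmin Θ' Θ' (fun r => P * Θ' r) (fun r => Θ' r * B) (fun _ => rfl) (fun _ => rfl)
        fun _ => rfl
      obtain rfl : (fun r => P * Θo r) = Wo := funext hWo
      obtain rfl : (fun r => Θo r * B) = Zo := funext hZo
      obtain rfl : Θo = Uo := funext hUo
      simp only [objF] at h1
      rw [hAdef, hAdef, hg, hg]
      simp only [constraintMap, LinearMap.coe_mk, AddHom.coe_mk]
      linarith⟩
    (L := L) hL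
    (fun v Y => (huniqTheta _ _ _ _ _ _).exists)
    (fun Θ Y => by
      obtain ⟨x, hx⟩ := (huniqWZU Θ (packTriple.symm Y).1 (packTriple.symm Y).2.1
        (packTriple.symm Y).2.2).exists
      exact ⟨packTriple x, fun v' => hx (packTriple.symm v')⟩)
    (a := Θb) (v := fun k => packTriple (Wk k, Zk k, Uk k))
    (Y := fun k => packTriple (Sk k, Tk k, Rk k)) (v' := fun k => packTriple (Wb k, Zb k, Ub k))
    (Y' := fun k => packTriple (Sb k, Tb k, Rb k))
    (fun k Θ' => hstep1 k Θ')
    (fun k => by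
      rw [hAdef, ← map_sub, ← map_smul, ← map_add, hstep2S, hstep2T, hstep2R]
      rfl)
    (fun k v' => hstep3 k (packTriple.symm v').1 (packTriple.symm v').2.1 (packTriple.symm v').2.2)
    (fun k => by
      simp only [← map_smul, ← map_sub, ← map_add]
      rw [hstep45W, hstep45Z, hstep45U]
      rfl)
    (fun k => by
      simp only [← map_smul, ← map_sub, ← map_add]
      rw [hstep45S, hstep45T, hstep45R]
      rfl)
  obtain ⟨⟨Ss, Ts, Rs⟩, rfl⟩ := packTriple.surjective Ys
  have cv := (continuous_packTriple_symm.tendsto _).comp hlimv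
  have cY := (continuous_packTriple_symm.tendsto _).comp hlimY
  have cA := (continuous_packTriple_symm.tendsto _).comp hlimA
  have hsub' : ∀ x : (Fin m → Matrix (Fin (t - 1)) (Fin s) ℝ)
      × (Fin m → Matrix (Fin t) (Fin e) ℝ) × (Fin m → Matrix (Fin t) (Fin s) ℝ),
      OmegaF (t - 1) s m lamt p (fun r => P * Θs r)
      + PhiF t e m s lamg q E w ι (fun r => Θs r * B) + PsiF t s m lam1 lam2 Θs
      + (ipF Ss (fun r => x.1 r - P * Θs r) + ipF Ts (fun r => x.2.1 r - Θs r * B)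
        + ipF Rs (fun r => x.2.2 r - Θs r))
      ≤ OmegaF (t - 1) s m lamt p x.1 + PhiF t e m s lamg q E w ι x.2.1
        + PsiF t s m lam1 lam2 x.2.2 := by
    intro x
    have h1 := hsub (packTriple x)
    rw [hAdef, ← map_sub, inner_packTriple, hg, hg] at h1
    exact h1
  have ipF_sub_self : ∀ {a b : ℕ} (S V : Fin m → Matrix (Fin a) (Fin b) ℝ),
      ipF S (fun r => V r - V r) = 0 := fun S V => by simp [ipF, frob]
  refine ⟨Θs, Θs, Rs, fun r => P * Θs r, Ss, fun r => Θs r * B, Ts, cA.snd_nhds.snd_nhds,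
    cv.fst_nhds, cv.snd_nhds.fst_nhds, cv.snd_nhds.snd_nhds, cY.fst_nhds, cY.snd_nhds.fst_nhds,
    cY.snd_nhds.snd_nhds, ?_, ?_, ?_, ?_, fun _ => rfl, fun _ => rfl, fun _ => rfl, ?_⟩
  · have hzero := ipF_self_eq_zero (A := fun r => lossGrad X y Θs r
      + (Pᵀ * Ss r + Ts r * Bᵀ + Rs r)) (by
        have h1 := hstat fun r => lossGrad X y Θs r + (Pᵀ * Ss r + Ts r * Bᵀ + Rs r)
        rw [hAdef, inner_packTriple_constraintMap] at h1
        rw [← h1]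
        simp only [ipFLinear, LinearMap.coe_mk, AddHom.coe_mk, ipF, frob_add_left,
          Finset.sum_add_distrib])
    intro r
    have h2 := congrFun hzero r
    simp only [lossGrad, ← add_assoc] at h2
    exact h2
  · intro W'
    have h1 := hsub' (W', fun r => Θs r * B, Θs)
    simp only [ipF_sub_self] at h1
    linarith
  · intro Z'
    have h1 := hsub' (fun r => P * Θs r, Z', Θs)
    simp only [ipF_sub_self] at h1
    linarith
  · intro U'
    have h1 := hsub' (fun r => P * Θs r, fun r => Θs r * B, U')
    simp only [ipF_sub_self] at h1
    linarith
  · intro Θ' U' W' Z' hW' hZ' hU'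
    obtain rfl : (fun r => P * Θ' r) = W' := funext hW'
    obtain rfl : (fun r => Θ' r * B) = Z' := funext hZ'
    obtain rfl : Θ' = U' := funext hU'
    have h1 := hbest Θ'
    rw [hAdef, hAdef, hg, hg] at h1
    simp only [constraintMap, LinearMap.coe_mk, AddHom.coe_mk] at h1
    simp only [objF]
    linarith
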